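/- arXiv:1701.01217 — 3 statements merged into one kernel-verified Lean document; each statement's English description precedes it below -/
import Mathlib

section
/- Let a < b be real numbers, let f : ℝ → ℝ be continuous on [a,b], let k : ℝ × ℝ → ℝ be continuous on [a,b] × [a,b] with |k(t,s)| ≤ M for all t,s ∈ [a,b], let ε > 0, and let ψ : ℝ → ℝ be continuous with |ψ(t) - f(t) - ∫_a^t k(t,s) ψ(s) ds| ≤ ε for all t ∈ [a,b]. Define ψ₀ = ψ and ψ_n(t) = f(t) + ∫_a^t k(t,s) ψ_{n-1}(s) ds for n ≥ 1. Then the sequence (ψ_n) converges uniformly on [a,b] to a continuous function φ, and φ satisfies φ(t) = f(t) + ∫_a^t k(t,s) φ(s) ds for all t ∈ [a,b]. -/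
section Volterra

open Set Filter Topology MeasureTheory

theorem ContinuousOn.volterra_integrand {a b t : ℝ} {k : ℝ × ℝ → ℝ} {x : ℝ → ℝ}
    (hk : ContinuousOn k (Icc a b ×ˢ Icc a b)) (hx : ContinuousOn x (Icc a b))
    (ht : t ∈ Icc a b) : ContinuousOn (fun s => k (t, s) * x s) (uIcc a t) := by
  rw [uIcc_of_le ht.1]
  have hsub : Icc a t ⊆ Icc a b := Icc_subset_Icc_right ht.2
  exact (hk.comp (by fun_prop) fun s hs => ⟨ht, hsub hs⟩).mul (hx.mono hsub)

theorem ContinuousOn.volterra_integral {a b : ℝ} {k : ℝ × ℝ → ℝ} {x : ℝ → ℝ}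
    (hk : ContinuousOn k (Icc a b ×ˢ Icc a b)) (hx : ContinuousOn x (Icc a b)) :
    ContinuousOn (fun t => ∫ s in a..t, k (t, s) * x s) (Icc a b) := by
  rcases lt_or_ge b a with hba | hab
  · simp [Icc_eq_empty_of_lt hba]
  have hproj : Continuous fun t => (projIcc a b hab t : ℝ) :=
    continuous_subtype_val.comp continuous_projIcc
  have hk' : Continuous fun p : ℝ × ℝ => k (projIcc a b hab p.1, projIcc a b hab p.2) :=
    hk.comp_continuous ((hproj.comp continuous_fst).prodMk (hproj.comp continuous_snd))
      fun p => ⟨(projIcc a b hab p.1).2, (projIcc a b hab p.2).2⟩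
  have hx' : Continuous fun t => x (projIcc a b hab t) :=
    hx.comp_continuous hproj fun t => (projIcc a b hab t).2
  have hcont : Continuous fun t =>
      ∫ s in a..t, k (projIcc a b hab t, projIcc a b hab s) * x (projIcc a b hab s) :=
    intervalIntegral.continuous_parametric_intervalIntegral_of_continuous
      (f := fun t s => k (projIcc a b hab t, projIcc a b hab s) * x (projIcc a b hab s))
      (hk'.mul (hx'.comp continuous_snd)) continuous_id
  refine hcont.continuousOn.congr fun t ht =>
    intervalIntegral.integral_congr fun s hs => ?_
  rw [uIcc_of_le ht.1] at hs
  simp only [projIcc_of_mem hab ht, projIcc_of_mem hab ⟨hs.1, hs.2.trans ht.2⟩]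

theorem abs_volterra_integral_le {a b M C : ℝ} {k : ℝ × ℝ → ℝ} {x : ℝ → ℝ} {n : ℕ}
    (hkM : ∀ t ∈ Icc a b, ∀ s ∈ Icc a b, |k (t, s)| ≤ M)
    (hx : ∀ s ∈ Icc a b, |x s| ≤ C * (M * (s - a)) ^ n / n.factorial)
    {t : ℝ} (ht : t ∈ Icc a b) :
    |∫ s in a..t, k (t, s) * x s| ≤ C * (M * (t - a)) ^ (n + 1) / (n + 1).factorial := by
  have hM : 0 ≤ M := (abs_nonneg _).trans (hkM t ht t ht)
  calc |∫ s in a..t, k (t, s) * x s|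
      ≤ ∫ s in a..t, M * (C * (M * (s - a)) ^ n / n.factorial) := by
        have hcont : Continuous fun s => M * (C * (M * (s - a)) ^ n / n.factorial) := by
          fun_prop
        rw [← Real.norm_eq_abs]
        refine intervalIntegral.norm_integral_le_of_norm_le ht.1 (ae_of_all _ fun s hs => ?_)
          (hcont.intervalIntegrable _ _)
        have hs' : s ∈ Icc a b := ⟨hs.1.le, hs.2.trans ht.2⟩
        rw [Real.norm_eq_abs, abs_mul]
        exact mul_le_mul (hkM t ht s hs') (hx s hs') (abs_nonneg _) hM
    _ = ∫ s in a..t, (M ^ (n + 1) * C / n.factorial) * (s - a) ^ n := by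
        congr 1
        ext s
        rw [mul_pow]
        ring
    _ = C * (M * (t - a)) ^ (n + 1) / (n + 1).factorial := by
        rw [intervalIntegral.integral_const_mul,
          intervalIntegral.integral_comp_sub_right (fun s => s ^ n), integral_pow,
          Nat.factorial_succ, mul_pow]
        push_cast
        field_simp
        ring

theorem TendstoUniformlyOn.tendsto_volterra_integral {a b M : ℝ} {k : ℝ × ℝ → ℝ}
    {x : ℕ → ℝ → ℝ} {y : ℝ → ℝ} (hk : ContinuousOn k (Icc a b ×ˢ Icc a b))
    (hkM : ∀ t ∈ Icc a b, ∀ s ∈ Icc a b, |k (t, s)| ≤ M)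
    (hx : ∀ n, ContinuousOn (x n) (Icc a b)) (hxy : TendstoUniformlyOn x y atTop (Icc a b))
    {t : ℝ} (ht : t ∈ Icc a b) :
    Tendsto (fun n => ∫ s in a..t, k (t, s) * x n s) atTop
      (𝓝 (∫ s in a..t, k (t, s) * y s)) := by
  have hM : 0 ≤ M := (abs_nonneg _).trans (hkM t ht t ht)
  refine TendstoUniformlyOn.tendsto_intervalIntegral_of_continuousOn
    (Eventually.of_forall fun n => hk.volterra_integrand (hx n) ht) ?_
  rw [uIcc_of_le ht.1, Metric.tendstoUniformlyOn_iff]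
  intro ε hε
  have hM1 : 0 < M + 1 := by positivity
  filter_upwards [Metric.tendstoUniformlyOn_iff.1 hxy (ε / (M + 1)) (by positivity)] with n hn s hs
  have hs' : s ∈ Icc a b := ⟨hs.1, hs.2.trans ht.2⟩
  have h1 := hn s hs'
  rw [Real.dist_eq] at h1 ⊢
  rw [← mul_sub, abs_mul]
  calc |k (t, s)| * |y s - x n s| ≤ (M + 1) * |y s - x n s| := by
        gcongr
        linarith [hkM t ht s hs']
    _ < (M + 1) * (ε / (M + 1)) := by gcongr
    _ = ε := by field_simp

theorem exists_tendstoUniformlyOn_of_summable_sub {α E : Type*} [NormedAddCommGroup E]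
    [CompleteSpace E] {s : Set α} {x : ℕ → α → E} {u : ℕ → ℝ} (hu : Summable u)
    (hx : ∀ n, ∀ t ∈ s, ‖x (n + 1) t - x n t‖ ≤ u n) :
    ∃ y : α → E, TendstoUniformlyOn x y atTop s := by
  refine ⟨fun t => x 0 t + ∑' n, (x (n + 1) t - x n t), ?_⟩
  have h := tendstoUniformlyOn_tsum_nat hu hx
  rw [Metric.tendstoUniformlyOn_iff] at h ⊢
  intro ε hε
  filter_upwards [h ε hε] with n hn t ht
  have h1 := hn t ht
  rw [Finset.sum_range_sub (fun n => x n t)] at h1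
  rwa [← dist_add_left (x 0 t), add_sub_cancel] at h1


end Volterra

/-- Uniform convergence of the Picard iterates on `[a, b]` to a continuous
solution of the Volterra integral equation. -/
theorem volterra_picard_uniform_convergence
    (a b M : ℝ) (hab : a < b)
    (f : ℝ → ℝ) (hf : ContinuousOn f (Set.Icc a b))
    (k : ℝ × ℝ → ℝ)
    (hk : ContinuousOn k (Set.Icc a b ×ˢ Set.Icc a b))
    (hkM : ∀ t ∈ Set.Icc a b, ∀ s ∈ Set.Icc a b, |k (t, s)| ≤ M)
    (ε : ℝ) (hε : 0 < ε)
    (ψ : ℝ → ℝ) (hψc : Continuous ψ)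
    (hψ : ∀ t ∈ Set.Icc a b, |ψ t - f t - ∫ s in a..t, k (t, s) * ψ s| ≤ ε)
    (Ψ : ℕ → ℝ → ℝ) (hΨ0 : Ψ 0 = ψ)
    (hΨ : ∀ n : ℕ, ∀ t : ℝ, Ψ (n + 1) t = f t + ∫ s in a..t, k (t, s) * Ψ n s) :
    ∃ φ : ℝ → ℝ, ContinuousOn φ (Set.Icc a b) ∧
      TendstoUniformlyOn (fun n => Ψ n) φ Filter.atTop (Set.Icc a b) ∧
      (∀ t ∈ Set.Icc a b, φ t = f t + ∫ s in a..t, k (t, s) * φ s) := by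
  have hΨc : ∀ n, ContinuousOn (Ψ n) (Set.Icc a b) := by
    intro n
    induction n with
    | zero => exact hΨ0 ▸ hψc.continuousOn
    | succ n ih => exact (hf.add (hk.volterra_integral ih)).congr fun t _ => hΨ n t
  have hdiff : ∀ n, ∀ t ∈ Set.Icc a b,
      |Ψ (n + 1) t - Ψ n t| ≤ ε * (M * (t - a)) ^ n / n.factorial := by
    intro n
    induction n with
    | zero =>
      intro t ht
      rw [hΨ, hΨ0, abs_sub_comm, ← sub_sub]
      simpa using hψ t ht
    | succ n ih =>
      intro t ht
      have heq : Ψ (n + 1 + 1) t - Ψ (n + 1) t =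
          ∫ s in a..t, k (t, s) * (Ψ (n + 1) s - Ψ n s) := by
        rw [hΨ (n + 1), hΨ n, add_sub_add_left_eq_sub, ← intervalIntegral.integral_sub
          (hk.volterra_integrand (hΨc _) ht).intervalIntegrable
          (hk.volterra_integrand (hΨc _) ht).intervalIntegrable]
        simp only [mul_sub]
      rw [heq]
      exact abs_volterra_integral_le hkM ih ht
  have hM : 0 ≤ M := by
    have ha : a ∈ Set.Icc a b := Set.left_mem_Icc.2 hab.le
    exact (abs_nonneg _).trans (hkM a ha a ha)
  obtain ⟨φ, hφ⟩ : ∃ φ, TendstoUniformlyOn Ψ φ Filter.atTop (Set.Icc a b) := by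
    refine exists_tendstoUniformlyOn_of_summable_sub
      ((Real.summable_pow_div_factorial (M * (b - a))).mul_left ε) fun n t ht => ?_
    refine (hdiff n t ht).trans ?_
    rw [mul_div_assoc]
    have h0 : 0 ≤ t - a := sub_nonneg.2 ht.1
    have h1 : t ≤ b := ht.2
    gcongr
  refine ⟨φ, hφ.continuousOn (Filter.Frequently.of_forall hΨc), hφ, fun t ht => ?_⟩
  refine tendsto_nhds_unique ((hφ.tendsto_at ht).comp (Filter.tendsto_add_atTop_nat 1)) ?_
  simp only [Function.comp_def, hΨ]
  exact (hφ.tendsto_volterra_integral hk hkM hΨc ht).const_add _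
end

section
/- Let a < b be real numbers, let f : ℝ → ℝ be continuous on [a,b], and let k : ℝ × ℝ → ℝ be continuous on [a,b] × [a,b] with |k(t,s)| ≤ M for all t,s ∈ [a,b]. Suppose x : ℝ → ℝ is continuous and satisfies x(t) = f(t) + ∫_a^t k(t,s) x(s) ds for all t ∈ [a,b], and ψ : ℝ → ℝ is continuous with |ψ(t) - f(t) - ∫_a^t k(t,s) ψ(s) ds| ≤ ε for all t ∈ [a,b], where ε > 0. Then |x(t) - ψ(t)| ≤ ε e^{M(t-a)} for all t ∈ [a,b]. -/
/-- Integral form of Grönwall's inequality with constant coefficients. -/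
theorem le_mul_exp_of_le_add_mul_integral {u : ℝ → ℝ} {a b M δ : ℝ} (hu : Continuous u)
    (hu0 : ∀ t, 0 ≤ u t) (hM : 0 ≤ M) (hδ : 0 ≤ δ)
    (h : ∀ t ∈ Set.Icc a b, u t ≤ δ + M * ∫ s in a..t, u s) :
    ∀ t ∈ Set.Icc a b, u t ≤ δ * Real.exp (M * (t - a)) := by
  intro t ht
  have hderiv (y : ℝ) : HasDerivAt (fun r => δ + M * ∫ s in a..r, u s) (M * u y) y :=
    ((hu.integral_hasStrictDerivAt a y).hasDerivAt.const_mul M).const_add δ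
  have hbound := norm_le_gronwallBound_of_norm_deriv_right_le (δ := δ) (K := M) (ε := 0)
    (a := a) (b := b)
    (fun y _ => (hderiv y).continuousAt.continuousWithinAt)
    (fun y _ => (hderiv y).hasDerivWithinAt) (by simp [abs_of_nonneg hδ])
    (fun y hy => by
      rw [Real.norm_of_nonneg (mul_nonneg hM (hu0 y)), add_zero]
      gcongr
      exact (h y (Set.Ico_subset_Icc_self hy)).trans (Real.le_norm_self _)) t ht
  rw [gronwallBound_ε0] at hbound
  exact (h t ht).trans ((Real.le_norm_self _).trans hbound)

/-- A kernel bounded by `M` gives an integral operator bounded by `M` times the integral. -/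
theorem abs_integral_kernel_mul_le {k u : ℝ → ℝ} {a t M : ℝ} (hat : a ≤ t) (hu : Continuous u)
    (hk : ∀ s ∈ Set.Icc a t, |k s| ≤ M) :
    |∫ s in a..t, k s * u s| ≤ M * ∫ s in a..t, |u s| := by
  rw [← intervalIntegral.integral_const_mul, ← Real.norm_eq_abs]
  refine intervalIntegral.norm_integral_le_of_norm_le hat
    (Filter.Eventually.of_forall fun s hs => ?_) ((hu.abs.const_mul M).intervalIntegrable a t)
  rw [Real.norm_eq_abs, abs_mul]
  exact mul_le_mul_of_nonneg_right (hk s (Set.Ioc_subset_Icc_self hs)) (abs_nonneg _)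

/-- An exact solution of the Volterra integral equation differs from an
`ε`-approximate solution by at most `ε * exp (M * (t - a))` on `[a, b]`. -/
theorem volterra_exact_vs_approximate
    (a b M : ℝ) (hab : a < b)
    (f : ℝ → ℝ) (hf : ContinuousOn f (Set.Icc a b))
    (k : ℝ × ℝ → ℝ)
    (hk : ContinuousOn k (Set.Icc a b ×ˢ Set.Icc a b))
    (hkM : ∀ t ∈ Set.Icc a b, ∀ s ∈ Set.Icc a b, |k (t, s)| ≤ M)
    (x : ℝ → ℝ) (hxc : Continuous x)
    (hx : ∀ t ∈ Set.Icc a b, x t = f t + ∫ s in a..t, k (t, s) * x s)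
    (ε : ℝ) (hε : 0 < ε)
    (ψ : ℝ → ℝ) (hψc : Continuous ψ)
    (hψ : ∀ t ∈ Set.Icc a b, |ψ t - f t - ∫ s in a..t, k (t, s) * ψ s| ≤ ε) :
    ∀ t ∈ Set.Icc a b, |x t - ψ t| ≤ ε * Real.exp (M * (t - a)) := by
  have ha : a ∈ Set.Icc a b := Set.left_mem_Icc.mpr hab.le
  have hM : 0 ≤ M := (abs_nonneg _).trans (hkM a ha a ha)
  refine le_mul_exp_of_le_add_mul_integral (hxc.sub hψc).abs (fun _ => abs_nonneg _) hM hε.le ?_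
  intro t ht
  have hsub : Set.Icc a t ⊆ Set.Icc a b := Set.Icc_subset_Icc_right ht.2
  have hkt : ContinuousOn (fun s => k (t, s)) (Set.uIcc a t) := by
    rw [Set.uIcc_of_le ht.1]
    exact hk.comp (by fun_prop) fun s hs => ⟨ht, hsub hs⟩
  have hint (y : ℝ → ℝ) (hy : Continuous y) :
      IntervalIntegrable (fun s => k (t, s) * y s) MeasureTheory.volume a t :=
    (hkt.mul hy.continuousOn).intervalIntegrable
  have hdiff : x t - ψ t = (∫ s in a..t, k (t, s) * (x s - ψ s)) -
      (ψ t - f t - ∫ s in a..t, k (t, s) * ψ s) := by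
    simp only [mul_sub]
    rw [intervalIntegral.integral_sub (hint x hxc) (hint ψ hψc), hx t ht]
    ring
  calc |x t - ψ t|
      ≤ |∫ s in a..t, k (t, s) * (x s - ψ s)| + |ψ t - f t - ∫ s in a..t, k (t, s) * ψ s| := by
        rw [hdiff]
        exact abs_sub _ _
    _ ≤ M * (∫ s in a..t, |x s - ψ s|) + ε :=
        add_le_add (abs_integral_kernel_mul_le ht.1 (hxc.sub hψc)
          fun s hs => hkM t ht s (hsub hs)) (hψ t ht)
    _ = ε + M * ∫ s in a..t, |x s - ψ s| := add_comm _ _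
end

section
/- Let a ≤ b be integers, let f : ℤ → ℝ and k : ℤ × ℤ → ℝ with |k(n,s)| ≤ M for all n,s ∈ [a,b] ∩ ℤ. Let ω : ℤ → ℝ be nonnegative on [a,b] ∩ ℤ and suppose there is P ∈ (0,1) with Σ_{s=a}^{n-1} ω(s) ≤ P ω(n) for all n ∈ [a,b] ∩ ℤ, and suppose M·P < 1. Then for every ψ : ℤ → ℝ satisfying |ψ(n) - f(n) - Σ_{s=a}^{n-1} k(n,s) ψ(s)| ≤ ω(n) for all n ∈ [a,b] ∩ ℤ, there exists φ : ℤ → ℝ satisfying φ(n) = f(n) + Σ_{s=a}^{n-1} k(n,s) φ(s) for all n ∈ [a,b] ∩ ℤ and such that |φ(n) - ψ(n)| ≤ (1 + 1/(1 - M·P)) ω(n) for all n ∈ [a,b] ∩ ℤ; i.e., the discrete Volterra equation has Hyers–Ulam–Rassias stability with respect to ω on [a,b] ∩ ℤ. -/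
/-- The solution of the discrete Volterra equation with initial point `a`, inhomogeneity `f`
and kernel `k`, defined by recursion on the distance to `a`. -/
noncomputable def volterraSolution (a : ℤ) (f : ℤ → ℝ) (k : ℤ × ℤ → ℝ) (n : ℤ) : ℝ :=
  f n + ∑ s : Finset.Ico a n, k (n, s.1) * volterraSolution a f k s.1
termination_by (n - a).toNat
decreasing_by
  have h := Finset.mem_Ico.mp s.2
  omega

theorem volterraSolution_eq (a : ℤ) (f : ℤ → ℝ) (k : ℤ × ℤ → ℝ) (n : ℤ) :
    volterraSolution a f k n =
      f n + ∑ s ∈ Finset.Ico a n, k (n, s) * volterraSolution a f k s := by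
  rw [volterraSolution,
    Finset.sum_coe_sort (Finset.Ico a n) fun s => k (n, s) * volterraSolution a f k s]

/-- A discrete Gronwall-type inequality: if `∑ s ∈ [a, n), ω s ≤ P * ω n` and
`d n ≤ ω n + M * ∑ s ∈ [a, n), d s`, then `d n ≤ ω n / (1 - M * P)`. -/
theorem le_of_le_add_mul_sum_Ico {a b : ℤ} {M P : ℝ} {ω d : ℤ → ℝ} (hM : 0 ≤ M)
    (hMP : M * P < 1)
    (hω : ∀ n ∈ Set.Icc a b, (∑ s ∈ Finset.Ico a n, ω s) ≤ P * ω n)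
    (hd : ∀ n ∈ Set.Icc a b, d n ≤ ω n + M * ∑ s ∈ Finset.Ico a n, d s)
    (n : ℤ) (hn : n ∈ Set.Icc a b) : d n ≤ 1 / (1 - M * P) * ω n := by
  have hpos : 0 < 1 - M * P := by linarith
  have hK : 0 ≤ 1 / (1 - M * P) := by positivity
  induction hm : (n - a).toNat using Nat.strong_induction_on generalizing n with
  | _ m ih =>
    have hsum : ∑ s ∈ Finset.Ico a n, d s ≤ 1 / (1 - M * P) * (P * ω n) :=
      calc ∑ s ∈ Finset.Ico a n, d s
          ≤ ∑ s ∈ Finset.Ico a n, 1 / (1 - M * P) * ω s := by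
            refine Finset.sum_le_sum fun s hs => ?_
            rw [Finset.mem_Ico] at hs
            exact ih _ (by omega) s ⟨hs.1, hs.2.le.trans hn.2⟩ rfl
        _ = 1 / (1 - M * P) * ∑ s ∈ Finset.Ico a n, ω s := (Finset.mul_sum ..).symm
        _ ≤ 1 / (1 - M * P) * (P * ω n) := mul_le_mul_of_nonneg_left (hω n hn) hK
    calc d n ≤ ω n + M * ∑ s ∈ Finset.Ico a n, d s := hd n hn
      _ ≤ ω n + M * (1 / (1 - M * P) * (P * ω n)) := by gcongr
      _ = 1 / (1 - M * P) * ω n := by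
        field_simp
        ring

/-- Hyers–Ulam–Rassias stability of the discrete Volterra equation on
`[a, b] ∩ ℤ` with respect to `ω`, with stability constant `1 + 1 / (1 - M * P)`. -/
theorem discrete_volterra_hyers_ulam_rassias_stability
    (a b : ℤ) (hab : a ≤ b) (M : ℝ)
    (f : ℤ → ℝ) (k : ℤ × ℤ → ℝ)
    (hkM : ∀ n ∈ Set.Icc a b, ∀ s ∈ Set.Icc a b, |k (n, s)| ≤ M)
    (ω : ℤ → ℝ) (hω0 : ∀ n ∈ Set.Icc a b, 0 ≤ ω n)
    (P : ℝ) (hP : P ∈ Set.Ioo (0 : ℝ) 1)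
    (hωP : ∀ n ∈ Set.Icc a b, (∑ s ∈ Finset.Ico a n, ω s) ≤ P * ω n)
    (hMP : M * P < 1)
    (ψ : ℤ → ℝ)
    (hψ : ∀ n ∈ Set.Icc a b,
      |ψ n - f n - ∑ s ∈ Finset.Ico a n, k (n, s) * ψ s| ≤ ω n) :
    ∃ φ : ℤ → ℝ,
      (∀ n ∈ Set.Icc a b, φ n = f n + ∑ s ∈ Finset.Ico a n, k (n, s) * φ s) ∧
      (∀ n ∈ Set.Icc a b, |φ n - ψ n| ≤ (1 + 1 / (1 - M * P)) * ω n) := by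
  have hM : 0 ≤ M := (abs_nonneg _).trans (hkM a ⟨le_rfl, hab⟩ a ⟨le_rfl, hab⟩)
  refine ⟨volterraSolution a f k, fun n _ => volterraSolution_eq a f k n, fun n hn => ?_⟩
  have hbound : |volterraSolution a f k n - ψ n| ≤ 1 / (1 - M * P) * ω n := by
    refine le_of_le_add_mul_sum_Ico (d := fun n => |volterraSolution a f k n - ψ n|)
      hM hMP hωP (fun n hn => ?_) n hn
    have hsplit : volterraSolution a f k n - ψ n =
        -(ψ n - f n - ∑ s ∈ Finset.Ico a n, k (n, s) * ψ s) +
          ∑ s ∈ Finset.Ico a n, k (n, s) * (volterraSolution a f k s - ψ s) := by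
      rw [volterraSolution_eq]
      simp only [mul_sub, Finset.sum_sub_distrib]
      ring
    rw [hsplit, Finset.mul_sum]
    refine (abs_add_le _ _).trans (add_le_add ?_ ?_)
    · rw [abs_neg]
      exact hψ n hn
    · refine (Finset.abs_sum_le_sum_abs _ _).trans (Finset.sum_le_sum fun s hs => ?_)
      rw [Finset.mem_Ico] at hs
      rw [abs_mul]
      exact mul_le_mul_of_nonneg_right (hkM n hn s ⟨hs.1, hs.2.le.trans hn.2⟩) (abs_nonneg _)
  linarith [hω0 n hn]
end
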